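/- arXiv:2511.09783 — 4 statements merged into one kernel-verified Lean document; each statement's English description precedes it below -/
import Mathlib

section
/- Sufficiency direction of the JEPA–Koopman theorem: if the encoder output is a combination of regime indicators, f(x) = χ₁(x)·c₁ + ⋯ + χ_r(x)·c_r with vectors c₁, …, c_r ∈ ℝ^k, and the k × k real matrix M fixes each of these vectors, M cⱼ = cⱼ for all j = 1, …, r, then the idealized JEPA loss vanishes: L(f, M) = ∫∫ ‖M f(x) − f(y)‖² d(μ ⊗ κ)(x, y) = 0. -/
open MeasureTheory ProbabilityTheory

/-- Along almost every transition of an invariant kernel, a measurable partition into dynamically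
invariant sets (up to null sets) has the same cells at both ends. -/
theorem ae_compProd_mem_iff_mem_of_invariant_partition {X ι : Type*} [MeasurableSpace X]
    [Countable ι] {μ : Measure X} [SFinite μ] {κ : Kernel X X} [IsMarkovKernel κ]
    (hinv : μ.bind κ = μ) {s : ι → Set X} (hmeas : ∀ i, MeasurableSet (s i))
    (hdisj : ∀ i j, i ≠ j → μ (s i ∩ s j) = 0) (hcover : μ (⋃ i, s i)ᶜ = 0)
    (hstay : ∀ i, ∀ᵐ x ∂μ, x ∈ s i → κ x (s i) = 1) :
    ∀ᵐ p ∂(μ ⊗ₘ κ), ∀ i, p.1 ∈ s i ↔ p.2 ∈ s i := by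
  have h_fst : (μ ⊗ₘ κ).map Prod.fst = μ := Measure.fst_compProd μ κ
  have h_snd : (μ ⊗ₘ κ).map Prod.snd = μ := (Measure.snd_compProd μ κ).trans hinv
  have h_step : ∀ᵐ p ∂(μ ⊗ₘ κ), ∀ i, p.1 ∈ s i → p.2 ∈ s i := by
    refine ae_all_iff.2 fun i => ?_
    refine (Measure.ae_compProd_iff ((measurable_fst (hmeas i)).imp (measurable_snd (hmeas i)))).2 ?_
    filter_upwards [hstay i] with x hx
    by_cases hxi : x ∈ s i
    · have : ∀ᵐ y ∂κ x, y ∈ s i := (prob_compl_eq_zero_iff (hmeas i)).2 (hx hxi)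
      filter_upwards [this] with y hy _ using hy
    · exact .of_forall fun y h => absurd h hxi
  have h_cover : ∀ᵐ p ∂(μ ⊗ₘ κ), p.1 ∈ ⋃ i, s i := by
    have h : ∀ᵐ x ∂μ, x ∈ ⋃ i, s i := hcover
    exact ae_of_ae_map measurable_fst.aemeasurable (h_fst.symm ▸ h)
  have h_disj : ∀ᵐ p ∂(μ ⊗ₘ κ), ∀ i j, i ≠ j → p.2 ∉ s i ∩ s j := by
    have h : ∀ᵐ y ∂μ, ∀ i j, i ≠ j → y ∉ s i ∩ s j := by
      simp_rw [ae_all_iff]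
      exact fun i j hij => measure_eq_zero_iff_ae_notMem.1 (hdisj i j hij)
    exact ae_of_ae_map measurable_snd.aemeasurable (h_snd.symm ▸ h)
  filter_upwards [h_step, h_cover, h_disj] with p hstep hcov hdis i
  refine ⟨hstep i, fun hi => ?_⟩
  obtain ⟨j, hj⟩ := Set.mem_iUnion.1 hcov
  obtain rfl : i = j := by_contra fun hij => hdis i j hij ⟨hi, hstep j hj⟩
  exact hj

/-- Sufficiency direction of the JEPA–Koopman theorem: if the encoder
output is a combination of regime indicators, `f(x) = χ₁(x)·c₁ + ⋯ + χ_r(x)·c_r`, and the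
matrix `M` fixes each vector `cⱼ`, then the idealized JEPA loss vanishes. -/
theorem jepa_loss_vanishes_on_regime_indicator_encoder
    {X : Type*} [MeasurableSpace X]
    (μ : Measure X) [IsProbabilityMeasure μ]
    (κ : Kernel X X) [IsMarkovKernel κ]
    (hinv : μ.bind (fun x => κ x) = μ)
    (r : ℕ) (hr : 1 ≤ r)
    (Xs : Fin r → Set X)
    (hmeas : ∀ i, MeasurableSet (Xs i))
    (hpos : ∀ i, 0 < μ (Xs i))
    (hdisj : ∀ i j, i ≠ j → μ (Xs i ∩ Xs j) = 0)
    (hcover : μ (⋃ i, Xs i)ᶜ = 0)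
    (hstay : ∀ i, ∀ᵐ x ∂μ, x ∈ Xs i → κ x (Xs i) = 1)
    (k : ℕ) (c : Fin r → EuclideanSpace ℝ (Fin k))
    (f : X → EuclideanSpace ℝ (Fin k))
    (hf : ∀ x, f x = ∑ j, (Xs j).indicator (fun _ => (1 : ℝ)) x • c j)
    (M : Matrix (Fin k) (Fin k) ℝ)
    (hMfix : ∀ j, M.mulVec (c j) = c j)
    -- the action of the matrix `M` on the encoder output
    (Mf : X → EuclideanSpace ℝ (Fin k)) (hMf : ∀ x, Mf x = M.mulVec (f x)) :
    (∫ p : X × X, ‖Mf p.1 - f p.2‖ ^ 2 ∂(μ ⊗ₘ κ)) = 0 := by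
  have h_fix : ∀ x, Mf x = f x := fun x => by
    ext a
    rw [hMf, hf]
    simp only [WithLp.ofLp_sum, WithLp.ofLp_smul, Matrix.mulVec_sum, Matrix.mulVec_smul, hMfix]
  refine integral_eq_zero_of_ae ?_
  filter_upwards [ae_compProd_mem_iff_mem_of_invariant_partition hinv hmeas hdisj hcover hstay]
    with p hp
  have h_eq : f p.1 = f p.2 := by
    classical
    simp only [hf, Set.indicator_apply, hp]
  simp [h_fix, h_eq]
end

section
/- The canonical encoder–predictor pair achieves zero JEPA loss: let k ≥ r, let f* : X → ℝ^k be defined by (f*(x))ᵢ = χᵢ(x) for 1 ≤ i ≤ r and (f*(x))ᵢ = 0 for r < i ≤ k, and let M* be any real k × k matrix whose top-left r × r block is the identity matrix I_r and whose bottom-left (k−r) × r block is the zero matrix (the two right-hand blocks M₁₂ and M₂₂ being arbitrary). Then L(f*, M*) = ∫∫ ‖M* f*(x) − f*(y)‖² d(μ ⊗ κ)(x, y) = 0. -/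
open MeasureTheory ProbabilityTheory

/-- A null set for an invariant measure is null for almost every transition law. -/
theorem ae_kernel_eq_zero_of_bind_eq {X : Type*} [MeasurableSpace X] {μ : Measure X}
    {κ : Kernel X X} (hinv : μ.bind (fun x => κ x) = μ) {s : Set X} (hs : MeasurableSet s)
    (h : μ s = 0) : ∀ᵐ x ∂μ, κ x s = 0 := by
  rw [← hinv, Measure.bind_apply hs κ.measurable.aemeasurable,
    lintegral_eq_zero_iff (κ.measurable_coe hs)] at h
  exact h

/-- A stationary chain stays almost surely in the same cells of an almost everywhere partition
into invariant sets. -/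
theorem ae_compProd_mem_iff_mem {X ι : Type*} [MeasurableSpace X] [Countable ι]
    {μ : Measure X} [SFinite μ] {κ : Kernel X X} [IsMarkovKernel κ]
    (hinv : μ.bind (fun x => κ x) = μ) {Xs : ι → Set X}
    (hmeas : ∀ i, MeasurableSet (Xs i)) (hdisj : ∀ i j, i ≠ j → μ (Xs i ∩ Xs j) = 0)
    (hcover : μ (⋃ i, Xs i)ᶜ = 0)
    (hstay : ∀ i, ∀ᵐ x ∂μ, x ∈ Xs i → κ x (Xs i) = 1) :
    ∀ᵐ p ∂(μ ⊗ₘ κ), ∀ i, p.1 ∈ Xs i ↔ p.2 ∈ Xs i := by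
  have hms : MeasurableSet {p : X × X | ∀ i, p.1 ∈ Xs i ↔ p.2 ∈ Xs i} := by
    rw [Set.ofPred_forall]
    exact MeasurableSet.iInter fun i =>
      (measurable_fst (hmeas i)).iff (measurable_snd (hmeas i))
  rw [Measure.ae_compProd_iff hms]
  have hnull : ∀ᵐ x ∂μ, ∀ i j, i ≠ j → κ x (Xs i ∩ Xs j) = 0 := by
    simp only [ae_all_iff]
    exact fun i j hij =>
      ae_kernel_eq_zero_of_bind_eq hinv ((hmeas i).inter (hmeas j)) (hdisj i j hij)
  have hcov : ∀ᵐ x ∂μ, x ∈ ⋃ i, Xs i := hcover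
  filter_upwards [hnull, hcov, ae_all_iff.2 hstay] with x hx hxc hxs
  rw [ae_all_iff]
  intro i
  by_cases hi : x ∈ Xs i
  · filter_upwards [(mem_ae_iff_prob_eq_one (hmeas i)).2 (hxs i hi)] with y hy
    exact iff_of_true hi hy
  · obtain ⟨j, hj⟩ := Set.mem_iUnion.1 hxc
    have hij : i ≠ j := fun h => hi (h ▸ hj)
    filter_upwards [(mem_ae_iff_prob_eq_one (hmeas j)).2 (hxs j hj),
      measure_eq_zero_iff_ae_notMem.1 (hx i j hij)] with y hy hy'
    exact iff_of_false hi fun h => hy' ⟨h, hy⟩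

/-- A matrix whose first `r` columns agree with those of the identity fixes every vector supported
on the first `r` coordinates. -/
theorem mulVec_eq_self_of_left_blocks {r k : ℕ} {M : Matrix (Fin k) (Fin k) ℝ}
    (hM₁₁ : ∀ i j : Fin k, (i : ℕ) < r → (j : ℕ) < r → M i j = if i = j then 1 else 0)
    (hM₂₁ : ∀ i j : Fin k, r ≤ (i : ℕ) → (j : ℕ) < r → M i j = 0)
    {v : Fin k → ℝ} (hv : ∀ i : Fin k, r ≤ (i : ℕ) → v i = 0) : M.mulVec v = v := by
  refine Eq.trans ?_ (Matrix.one_mulVec v)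
  ext i
  simp only [Matrix.mulVec, dotProduct]
  refine Finset.sum_congr rfl fun j _ => ?_
  rcases lt_or_ge (j : ℕ) r with hj | hj
  · rcases lt_or_ge (i : ℕ) r with hi | hi
    · rw [hM₁₁ i j hi hj, Matrix.one_apply]
    · rw [hM₂₁ i j hi hj, Matrix.one_apply_ne (fun h => by subst h; omega)]
  · rw [hv j hj, mul_zero, mul_zero]

/-- The canonical encoder–predictor pair achieves zero JEPA loss:
with `k ≥ r`, `(f*(x))ᵢ = χᵢ(x)` for `i < r` and `0` otherwise, and `M*` any matrix whose
top-left `r × r` block is the identity and whose bottom-left `(k−r) × r` block is zero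
(the right-hand blocks being arbitrary), one has `L(f*, M*) = 0`. -/
theorem canonical_pair_achieves_zero_jepa_loss
    {X : Type*} [MeasurableSpace X]
    (μ : Measure X) [IsProbabilityMeasure μ]
    (κ : Kernel X X) [IsMarkovKernel κ]
    (hinv : μ.bind (fun x => κ x) = μ)
    (r : ℕ) (hr : 1 ≤ r)
    (Xs : Fin r → Set X)
    (hmeas : ∀ i, MeasurableSet (Xs i))
    (hpos : ∀ i, 0 < μ (Xs i))
    (hdisj : ∀ i j, i ≠ j → μ (Xs i ∩ Xs j) = 0)
    (hcover : μ (⋃ i, Xs i)ᶜ = 0)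
    (hstay : ∀ i, ∀ᵐ x ∂μ, x ∈ Xs i → κ x (Xs i) = 1)
    (k : ℕ) (hkr : r ≤ k)
    (fstar : X → EuclideanSpace ℝ (Fin k))
    (hfstar : ∀ x, ∀ i : Fin k, fstar x i =
      if h : (i : ℕ) < r then (Xs ⟨i, h⟩).indicator (fun _ => (1 : ℝ)) x else 0)
    (Mstar : Matrix (Fin k) (Fin k) ℝ)
    -- top-left r × r block is the identity
    (hM₁₁ : ∀ i j : Fin k, (i : ℕ) < r → (j : ℕ) < r →
      Mstar i j = if i = j then 1 else 0)
    -- bottom-left (k − r) × r block is zero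
    (hM₂₁ : ∀ i j : Fin k, r ≤ (i : ℕ) → (j : ℕ) < r → Mstar i j = 0)
    -- the action of the matrix `M*` on the encoder output
    (Mfstar : X → EuclideanSpace ℝ (Fin k))
    (hMfstar : ∀ x, Mfstar x = Mstar.mulVec (fstar x)) :
    (∫ p : X × X, ‖Mfstar p.1 - fstar p.2‖ ^ 2 ∂(μ ⊗ₘ κ)) = 0 := by
  have hfix : ∀ x, Mfstar x = fstar x := fun x => by
    ext i
    rw [hMfstar x, mulVec_eq_self_of_left_blocks hM₁₁ hM₂₁]
    intro j hj
    rw [hfstar, dif_neg hj.not_gt]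
  refine integral_eq_zero_of_ae ?_
  filter_upwards [ae_compProd_mem_iff_mem hinv hmeas hdisj hcover hstay] with p hp
  have hconst : fstar p.1 = fstar p.2 := by
    ext i
    rw [hfstar, hfstar]
    refine dite_congr rfl (fun h => ?_) fun _ => rfl
    classical
    simp only [Set.indicator_apply, hp]
  simp [hfix, hconst]
end

section
/- Characterization of the optimal linear predictors for the canonical encoder: let k ≥ r and let f* : X → ℝ^k be defined by (f*(x))ᵢ = χᵢ(x) for 1 ≤ i ≤ r and (f*(x))ᵢ = 0 for r < i ≤ k. Then for a real k × k matrix M, the idealized JEPA loss L(f*, M) = ∫∫ ‖M f*(x) − f*(y)‖² d(μ ⊗ κ)(x, y) equals 0 if and only if the top-left r × r block of M is the identity matrix I_r and the bottom-left (k−r) × r block of M is the zero matrix; the right-hand blocks of M are unconstrained. -/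
open MeasureTheory ProbabilityTheory

/-- If the pairwise intersections of the invariant sets `Xs i` are null and their union is conull
for an invariant measure, then almost every `x` lies in exactly one `Xs i`, and so does `κ x`-almost
every `y`, with the same index. -/
theorem ae_exists_forall_mem_iff_of_invariant {X ι : Type*} [Countable ι] [MeasurableSpace X]
    {μ : Measure X} {κ : Kernel X X} [IsMarkovKernel κ]
    (hinv : μ.bind (fun x => κ x) = μ) {Xs : ι → Set X}
    (hmeas : ∀ i, MeasurableSet (Xs i))
    (hdisj : ∀ i j, i ≠ j → μ (Xs i ∩ Xs j) = 0)
    (hcover : μ (⋃ i, Xs i)ᶜ = 0)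
    (hstay : ∀ i, ∀ᵐ x ∂μ, x ∈ Xs i → κ x (Xs i) = 1) :
    ∀ᵐ x ∂μ, ∃ i, (∀ j, x ∈ Xs j ↔ j = i) ∧ ∀ᵐ y ∂κ x, ∀ j, y ∈ Xs j ↔ j = i := by
  have hsep : ∀ᵐ x ∂μ, ∀ i j, i ≠ j → x ∉ Xs i ∩ Xs j := by
    simp only [ae_all_iff]
    exact fun i j hij => measure_eq_zero_iff_ae_notMem.1 (hdisj i j hij)
  have hsep' : ∀ᵐ x ∂μ, ∀ᵐ y ∂κ x, ∀ i j, i ≠ j → y ∉ Xs i ∩ Xs j := by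
    rw [← hinv] at hsep
    exact Measure.ae_ae_of_ae_bind κ.measurable.aemeasurable hsep
  filter_upwards [hsep, hsep', measure_eq_zero_iff_ae_notMem.1 hcover, ae_all_iff.2 hstay]
    with x h1 h2 h3 h4
  obtain ⟨i, hi⟩ : ∃ i, x ∈ Xs i := by simpa using h3
  refine ⟨i, fun j => ⟨fun hj => ?_, fun h => h ▸ hi⟩, ?_⟩
  · by_contra hne
    exact h1 j i hne ⟨hj, hi⟩
  · have hy : ∀ᵐ y ∂κ x, y ∈ Xs i := (mem_ae_iff_prob_eq_one (hmeas i)).2 (h4 i hi)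
    filter_upwards [h2, hy] with y hy2 hyi j
    refine ⟨fun hj => ?_, fun h => h ▸ hyi⟩
    by_contra hne
    exact hy2 j i hne ⟨hj, hyi⟩

theorem integral_norm_sub_sq_compProd_eq_zero_iff {X Y E : Type*} [MeasurableSpace X]
    [MeasurableSpace Y] [NormedAddCommGroup E] [MeasurableSpace E] [BorelSpace E]
    [SecondCountableTopology E] {μ : Measure X} [SFinite μ] {κ : Kernel X Y} [IsSFiniteKernel κ]
    {F : X → E} {G : Y → E} (hF : Measurable F) (hG : Measurable G)
    (hint : Integrable (fun p : X × Y => ‖F p.1 - G p.2‖ ^ 2) (μ ⊗ₘ κ)) :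
    (∫ p : X × Y, ‖F p.1 - G p.2‖ ^ 2 ∂(μ ⊗ₘ κ)) = 0 ↔ ∀ᵐ x ∂μ, ∀ᵐ y ∂κ x, F x = G y := by
  have hset : MeasurableSet {p : X × Y | F p.1 = G p.2} :=
    measurableSet_eq_fun (hF.comp measurable_fst) (hG.comp measurable_snd)
  rw [integral_eq_zero_iff_of_nonneg (fun p => sq_nonneg _) hint,
    ← Measure.ae_compProd_iff hset]
  simp [Filter.EventuallyEq, sub_eq_zero]

/-- Characterization of the optimal linear predictors for the canonical
encoder: with `k ≥ r` and `(f*(x))ᵢ = χᵢ(x)` for `i < r`, `0` otherwise, the idealized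
JEPA loss `L(f*, M)` equals `0` iff the top-left `r × r` block of `M` is the identity and
the bottom-left `(k−r) × r` block of `M` is zero (the right-hand blocks unconstrained). -/
theorem optimal_linear_predictors_characterization
    {X : Type*} [MeasurableSpace X]
    (μ : Measure X) [IsProbabilityMeasure μ]
    (κ : Kernel X X) [IsMarkovKernel κ]
    (hinv : μ.bind (fun x => κ x) = μ)
    (r : ℕ) (hr : 1 ≤ r)
    (Xs : Fin r → Set X)
    (hmeas : ∀ i, MeasurableSet (Xs i))
    (hpos : ∀ i, 0 < μ (Xs i))
    (hdisj : ∀ i j, i ≠ j → μ (Xs i ∩ Xs j) = 0)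
    (hcover : μ (⋃ i, Xs i)ᶜ = 0)
    (hstay : ∀ i, ∀ᵐ x ∂μ, x ∈ Xs i → κ x (Xs i) = 1)
    (k : ℕ) (hkr : r ≤ k)
    (fstar : X → EuclideanSpace ℝ (Fin k))
    (hfstar : ∀ x, ∀ i : Fin k, fstar x i =
      if h : (i : ℕ) < r then (Xs ⟨i, h⟩).indicator (fun _ => (1 : ℝ)) x else 0)
    (M : Matrix (Fin k) (Fin k) ℝ)
    -- the action of the matrix `M` on the encoder output
    (Mfstar : X → EuclideanSpace ℝ (Fin k))
    (hMfstar : ∀ x, Mfstar x = M.mulVec (fstar x)) :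
    (∫ p : X × X, ‖Mfstar p.1 - fstar p.2‖ ^ 2 ∂(μ ⊗ₘ κ)) = 0 ↔
      ((∀ i j : Fin k, (i : ℕ) < r → (j : ℕ) < r → M i j = if i = j then 1 else 0) ∧
        (∀ i j : Fin k, r ≤ (i : ℕ) → (j : ℕ) < r → M i j = 0)) := by
  classical
  have hregime := ae_exists_forall_mem_iff_of_invariant hinv hmeas hdisj hcover hstay
  have hbasis : ∀ x i, (∀ j, x ∈ Xs j ↔ j = i) →
      fstar x = EuclideanSpace.single (Fin.castLE hkr i) 1 := by
    intro x i hx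
    ext a
    rw [hfstar]
    by_cases ha : (a : ℕ) < r <;>
      simp [ha, Set.indicator_apply, hx, Fin.ext_iff]
    lia
  have hcol : ∀ x i, fstar x = EuclideanSpace.single (Fin.castLE hkr i) 1 →
      ∀ a, Mfstar x a = M a (Fin.castLE hkr i) := by
    intro x i hx a
    rw [hMfstar, hx]
    simp
  have hmeasf : Measurable fstar := by
    refine (WithLp.measurable_toLp 2 _).comp
      (measurable_pi_iff.2 fun i => ?_ : Measurable fun x => (fstar x).ofLp)
    simp only [hfstar]
    split_ifs with h
    · exact measurable_const.indicator (hmeas _)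
    · exact measurable_const
  have hMf : Mfstar = fun x => Matrix.toEuclideanCLM (𝕜 := ℝ) M (fstar x) := by
    funext x
    ext a
    rw [hMfstar]
    simp
  have hmeasM : Measurable Mfstar := by
    rw [hMf]
    exact (ContinuousLinearMap.continuous _).measurable.comp hmeasf
  have hmeasL : Measurable fun p : X × X => ‖Mfstar p.1 - fstar p.2‖ ^ 2 := by fun_prop
  have hbound : ∀ x, ‖fstar x‖ ≤ ∑ _i : Fin k, (1 : ℝ) := by
    intro x
    rw [← (EuclideanSpace.basisFun (Fin k) ℝ).sum_repr (fstar x)]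
    refine norm_sum_le_of_le _ fun i _ => ?_
    simp only [EuclideanSpace.basisFun_repr, EuclideanSpace.basisFun_apply, norm_smul, hfstar,
      Set.indicator_apply]
    split_ifs <;> simp
  have hint : Integrable (fun p : X × X => ‖Mfstar p.1 - fstar p.2‖ ^ 2) (μ ⊗ₘ κ) := by
    refine Integrable.of_bound hmeasL.aestronglyMeasurable
      ((‖Matrix.toEuclideanCLM (𝕜 := ℝ) M‖ * (∑ _i : Fin k, (1 : ℝ)) +
        ∑ _i : Fin k, (1 : ℝ)) ^ 2) (.of_forall fun p => ?_)
    rw [Real.norm_of_nonneg (by positivity)]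
    gcongr
    refine (norm_sub_le _ _).trans (add_le_add ?_ (hbound _))
    rw [hMf]
    exact ContinuousLinearMap.le_opNorm_of_le _ (hbound _)
  have hzero : (∫ p : X × X, ‖Mfstar p.1 - fstar p.2‖ ^ 2 ∂(μ ⊗ₘ κ)) = 0 ↔
      ∀ᵐ x ∂μ, ∀ᵐ y ∂κ x, Mfstar x = fstar y :=
    integral_norm_sub_sq_compProd_eq_zero_iff hmeasM hmeasf hint
  have hblock : ((∀ i j : Fin k, (i : ℕ) < r → (j : ℕ) < r → M i j = if i = j then 1 else 0) ∧
        (∀ i j : Fin k, r ≤ (i : ℕ) → (j : ℕ) < r → M i j = 0)) ↔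
      ∀ (j : Fin r) (a : Fin k), M a (Fin.castLE hkr j) =
        (EuclideanSpace.single (Fin.castLE hkr j) (1 : ℝ) : EuclideanSpace ℝ (Fin k)) a := by
    simp only [PiLp.single_apply]
    constructor
    · rintro ⟨h1, h2⟩ j a
      by_cases ha : (a : ℕ) < r
      · exact h1 a _ ha j.2
      · rw [h2 a _ (not_lt.1 ha) j.2, if_neg]
        rintro rfl
        exact ha j.2
    · intro h
      refine ⟨fun i j _ hj => h ⟨j, hj⟩ i, fun i j hi hj => (h ⟨j, hj⟩ i).trans (if_neg ?_)⟩
      rintro rfl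
      exact absurd hj (not_lt.2 hi)
  rw [hzero, hblock]
  constructor
  · intro h j a
    obtain ⟨x, hxj, ⟨i, hx, hxy⟩, hM⟩ :=
      ((frequently_ae_mem_iff.2 (hpos j).ne').and_eventually (hregime.and h)).exists
    obtain rfl := (hx j).1 hxj
    obtain ⟨y, hy, hMy⟩ := (hxy.and hM).exists
    rw [← hcol x j (hbasis x j hx), hMy, hbasis y j hy]
  · intro h
    filter_upwards [hregime] with x ⟨i, hx, hxy⟩
    filter_upwards [hxy] with y hy
    ext a
    rw [hcol x i (hbasis x i hx), hbasis y i hy, h]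
end

section
/- Full eigenspace identification (Lemma 1(d)): assume each regime is ergodic, meaning for every measurable set A ⊆ X, if for (μ ⊗ κ)-almost every pair (x, y) with x ∈ Xᵢ one has y ∈ A ↔ x ∈ A, then μ(A ∩ Xᵢ) = 0 or μ(A ∩ Xᵢ) = μ(Xᵢ). Then the fixed subspace of the Koopman operator in L²(X, μ), namely {ψ ∈ L²(X, μ) : Kψ = ψ μ-a.e.}, equals the linear span of the classes [χ₁], …, [χ_r] of the regime indicators, and this subspace has dimension exactly r. -/
open MeasureTheory ProbabilityTheory

namespace ProbabilityTheory.Kernel.Invariant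

variable {X : Type*} [MeasurableSpace X] {μ : Measure X} {κ : Kernel X X}

lemma ae_ae (hinv : κ.Invariant μ) {p : X → Prop} (h : ∀ᵐ x ∂μ, p x) :
    ∀ᵐ x ∂μ, ∀ᵐ y ∂κ x, p y :=
  Measure.ae_ae_of_ae_comp (by rwa [hinv.def])

lemma ae_integrable [SFinite μ] [IsSFiniteKernel κ] (hinv : κ.Invariant μ) {f : X → ℝ}
    (hf : Integrable f μ) : ∀ᵐ x ∂μ, Integrable f (κ x) :=
  Measure.ae_integrable_of_integrable_comp (by rwa [hinv.def])

lemma measurePreserving_snd [SFinite μ] [IsSFiniteKernel κ] (hinv : κ.Invariant μ) :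
    MeasurePreserving Prod.snd (μ ⊗ₘ κ) μ :=
  ⟨measurable_snd, (Measure.snd_compProd μ κ).trans hinv.def⟩

/-- A square-integrable function fixed by the Koopman operator of an invariant Markov kernel is
almost surely constant along transitions. -/
lemma ae_snd_eq_fst [SFinite μ] [IsMarkovKernel κ] (hinv : κ.Invariant μ) {f : X → ℝ}
    (hf : MemLp f 2 μ) (hfix : ∀ᵐ x ∂μ, ∫ y, f y ∂κ x = f x) :
    ∀ᵐ p ∂(μ ⊗ₘ κ), f p.2 = f p.1 := by
  have hfst : MeasurePreserving Prod.fst (μ ⊗ₘ κ) μ :=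
    ⟨measurable_fst, Measure.fst_compProd μ κ⟩
  have hsnd := hinv.measurePreserving_snd
  have h₁ : MemLp (fun p : X × X ↦ f p.1) 2 (μ ⊗ₘ κ) := hf.comp_measurePreserving hfst
  have h₂ : MemLp (fun p : X × X ↦ f p.2) 2 (μ ⊗ₘ κ) := hf.comp_measurePreserving hsnd
  have hsq₁ : ∫ p, f p.1 ^ 2 ∂(μ ⊗ₘ κ) = ∫ x, f x ^ 2 ∂μ := by
    conv_rhs => rw [← hfst.map_eq]
    rw [integral_map hfst.aemeasurable]
    rw [hfst.map_eq]
    exact hf.integrable_sq.aestronglyMeasurable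
  have hsq₂ : ∫ p, f p.2 ^ 2 ∂(μ ⊗ₘ κ) = ∫ x, f x ^ 2 ∂μ := by
    conv_rhs => rw [← hsnd.map_eq]
    rw [integral_map hsnd.aemeasurable]
    rw [hsnd.map_eq]
    exact hf.integrable_sq.aestronglyMeasurable
  have hmul : Integrable (fun p : X × X ↦ f p.1 * f p.2) (μ ⊗ₘ κ) := h₁.integrable_mul h₂
  have hcross : ∫ p, f p.1 * f p.2 ∂(μ ⊗ₘ κ) = ∫ x, f x ^ 2 ∂μ := by
    rw [Measure.integral_compProd hmul]
    refine integral_congr_ae ?_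
    filter_upwards [hfix] with x hx
    rw [integral_const_mul, hx, sq]
  have hzero : ∫ p, (f p.2 - f p.1) ^ 2 ∂(μ ⊗ₘ κ) = 0 := by
    have hexp : (fun p : X × X ↦ (f p.2 - f p.1) ^ 2) =
        fun p ↦ (f p.2 ^ 2 + f p.1 ^ 2) - 2 * (f p.1 * f p.2) := by
      funext p
      ring
    have hadd : Integrable (fun p : X × X ↦ f p.2 ^ 2 + f p.1 ^ 2) (μ ⊗ₘ κ) :=
      h₂.integrable_sq.add h₁.integrable_sq
    rw [hexp, integral_sub hadd (hmul.const_mul 2),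
      integral_add h₂.integrable_sq h₁.integrable_sq, integral_const_mul, hsq₁, hsq₂, hcross]
    ring
  have hae := (integral_eq_zero_iff_of_nonneg (fun _ ↦ sq_nonneg _)
    (h₂.sub h₁).integrable_sq).1 hzero
  filter_upwards [hae] with p hp
  exact sub_eq_zero.1 (pow_eq_zero_iff two_ne_zero |>.1 hp)

/-- A measurable function constant along transitions is almost everywhere constant on an ergodic
regime. -/
lemma exists_ae_eq_const_of_ergodic [IsFiniteMeasure μ] {f : X → ℝ} (hf : Measurable f)
    {S : Set X} (hS : MeasurableSet S) (hconst : ∀ᵐ p ∂(μ ⊗ₘ κ), f p.2 = f p.1)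
    (herg : ∀ A : Set X, MeasurableSet A →
      (∀ᵐ p : X × X ∂(μ ⊗ₘ κ), p.1 ∈ S → (p.2 ∈ A ↔ p.1 ∈ A)) →
      μ (A ∩ S) = 0 ∨ μ (A ∩ S) = μ S) :
    ∃ c : ℝ, ∀ᵐ x ∂μ, x ∈ S → f x = c := by
  suffices h : ∃ c, f =ᵐ[μ.restrict S] Function.const X c by
    obtain ⟨c, hc⟩ := h
    exact ⟨c, (ae_restrict_iff' hS).1 hc⟩
  refine Filter.exists_eventuallyEq_const_of_forall_separating MeasurableSet fun U hU ↦ ?_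
  have hA : MeasurableSet (f ⁻¹' U) := hf hU
  rcases herg (f ⁻¹' U) hA (by
    filter_upwards [hconst] with p hp _
    simp [hp]) with h | h
  · right
    rw [ae_iff]
    simp only [not_not]
    rw [← Measure.restrict_apply hA] at h
    exact h
  · left
    rw [ae_iff]
    change μ.restrict S (f ⁻¹' U)ᶜ = 0
    rw [measure_compl hA (measure_ne_top _ _), Measure.restrict_apply hA, h,
      Measure.restrict_apply_univ, tsub_self]

/-- The Koopman operator of an invariant Markov kernel fixes the indicator of each member of an
almost everywhere partition into dynamically invariant sets. -/
lemma ae_integral_indicator_eq [IsMarkovKernel κ] (hinv : κ.Invariant μ)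
    {ι : Type*} [Countable ι] {S : ι → Set X} (hS : ∀ i, MeasurableSet (S i))
    (hdisj : ∀ i j, i ≠ j → μ (S i ∩ S j) = 0) (hcover : μ (⋃ i, S i)ᶜ = 0)
    (hstay : ∀ i, ∀ᵐ x ∂μ, x ∈ S i → κ x (S i) = 1) (i : ι) :
    ∀ᵐ x ∂μ, ∫ y, (S i).indicator (fun _ ↦ (1 : ℝ)) y ∂κ x =
      (S i).indicator (fun _ ↦ (1 : ℝ)) x := by
  have hcov : ∀ᵐ x ∂μ, x ∈ ⋃ j, S j := hcover
  have hd : ∀ᵐ x ∂μ, ∀ j, i ≠ j → κ x (S i ∩ S j) = 0 := by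
    refine ae_all_iff.2 fun j ↦ ?_
    by_cases hij : i = j
    · simp [hij]
    have h := hinv.ae_ae (p := fun y ↦ y ∉ S i ∩ S j)
      (measure_eq_zero_iff_ae_notMem.1 (hdisj i j hij))
    filter_upwards [h] with x hx _ using measure_eq_zero_iff_ae_notMem.2 hx
  filter_upwards [hcov, hd, ae_all_iff.2 hstay] with x hx hdx hsx
  rw [integral_indicator_const _ (hS i)]
  by_cases hxi : x ∈ S i
  · simp [hxi, measureReal_def, hsx i hxi]
  · obtain ⟨j, hj⟩ := Set.mem_iUnion.1 hx
    have hij : i ≠ j := by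
      rintro rfl
      exact hxi hj
    have hcompl : κ x (S j)ᶜ = 0 := (prob_compl_eq_zero_iff (hS j)).2 (hsx j hj)
    have hzero : κ x (S i) = 0 := by
      rw [← measure_inter_add_sdiff (S i) (hS j), hdx j hij, zero_add]
      exact measure_mono_null (fun y hy ↦ hy.2) hcompl
    simp [hxi, measureReal_def, hzero]

end ProbabilityTheory.Kernel.Invariant

lemma MeasureTheory.linearIndependent_indicatorConstLp_one {X ι : Type*} [MeasurableSpace X]
    {μ : Measure X} [IsFiniteMeasure μ] {S : ι → Set X} (hS : ∀ i, MeasurableSet (S i))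
    (hpos : ∀ i, 0 < μ (S i)) (hdisj : ∀ i j, i ≠ j → μ (S i ∩ S j) = 0) :
    LinearIndependent ℝ
      fun i ↦ indicatorConstLp 2 (hS i) (measure_ne_top μ (S i)) (1 : ℝ) := by
  refine linearIndependent_of_ne_zero_of_inner_eq_zero (𝕜 := ℝ) (fun i h ↦ ?_)
    fun i j hij ↦ ?_
  · have h' := L2.real_inner_indicatorConstLp_one_indicatorConstLp_one (μ := μ) (hS i) (hS i)
    rw [h, inner_zero_left, Set.inter_self] at h'
    exact (measureReal_ne_zero_iff (measure_ne_top μ (S i))).2 (hpos i).ne' h'.symm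
  · refine (L2.real_inner_indicatorConstLp_one_indicatorConstLp_one (hS i) (hS j)).trans ?_
    rw [measureReal_def, hdisj i j hij, ENNReal.toReal_zero]

lemma MeasureTheory.Lp.mem_span_indicatorConstLp {X ι : Type*} [MeasurableSpace X] [Fintype ι]
    {μ : Measure X} [IsFiniteMeasure μ] {S : ι → Set X} (hS : ∀ i, MeasurableSet (S i))
    (hdisj : ∀ i j, i ≠ j → μ (S i ∩ S j) = 0) (hcover : μ (⋃ i, S i)ᶜ = 0) (ψ : Lp ℝ 2 μ)
    (c : ι → ℝ) (hc : ∀ i, ∀ᵐ x ∂μ, x ∈ S i → ψ x = c i) :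
    ψ ∈ Submodule.span ℝ (Set.range
      fun i ↦ indicatorConstLp 2 (hS i) (measure_ne_top μ (S i)) (1 : ℝ)) := by
  refine (Submodule.mem_span_range_iff_exists_fun ℝ).2 ⟨c, Lp.ext ?_⟩
  have hcov : ∀ᵐ x ∂μ, x ∈ ⋃ j, S j := hcover
  have hd : ∀ᵐ x ∂μ, ∀ i j, i ≠ j → x ∉ S i ∩ S j :=
    ae_all_iff.2 fun i ↦ ae_all_iff.2 fun j ↦ by
      by_cases hij : i = j
      · simp [hij]
      · filter_upwards [measure_eq_zero_iff_ae_notMem.1 (hdisj i j hij)] with x hx _ using hx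
  have hχ : ∀ᵐ x ∂μ, ∀ i, indicatorConstLp 2 (hS i) (measure_ne_top μ (S i)) (1 : ℝ) x =
      (S i).indicator (fun _ ↦ (1 : ℝ)) x := ae_all_iff.2 fun i ↦ indicatorConstLp_coeFn
  have hsmul : ∀ᵐ x ∂μ, ∀ i,
      (c i • indicatorConstLp 2 (hS i) (measure_ne_top μ (S i)) (1 : ℝ) : Lp ℝ 2 μ) x =
      c i * indicatorConstLp 2 (hS i) (measure_ne_top μ (S i)) (1 : ℝ) x :=
    ae_all_iff.2 fun i ↦ Lp.coeFn_smul _ _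
  filter_upwards [hcov, hd, hχ, hsmul, ae_all_iff.2 hc, Lp.coeFn_finsetSum Finset.univ
    fun i ↦ c i • indicatorConstLp 2 (hS i) (measure_ne_top μ (S i)) (1 : ℝ)]
    with x hx hdx hχx hsx hcx hsum
  obtain ⟨j, hj⟩ := Set.mem_iUnion.1 hx
  rw [hsum, Finset.sum_apply, hcx j hj, Finset.sum_eq_single j]
  · simp [hsx, hχx, hj]
  · intro i _ hij
    have hi : x ∉ S i := fun hi ↦ hdx i j hij ⟨hi, hj⟩
    simp [hsx, hχx, hi]
  · simp

/-- Full eigenspace identification (Lemma 1(d)): if each regime is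
ergodic, then the fixed subspace of the Koopman operator in `L²(X, μ)` equals the linear
span of the classes `[χ₁], …, [χ_r]` of the regime indicators, and it has dimension
exactly `r`. -/
theorem koopman_fixed_subspace_eq_span_of_indicators
    {X : Type*} [MeasurableSpace X]
    (μ : Measure X) [IsProbabilityMeasure μ]
    (κ : Kernel X X) [IsMarkovKernel κ]
    (hinv : μ.bind (fun x => κ x) = μ)
    (r : ℕ) (hr : 1 ≤ r)
    (Xs : Fin r → Set X)
    (hmeas : ∀ i, MeasurableSet (Xs i))
    (hpos : ∀ i, 0 < μ (Xs i))
    (hdisj : ∀ i j, i ≠ j → μ (Xs i ∩ Xs j) = 0)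
    (hcover : μ (⋃ i, Xs i)ᶜ = 0)
    (hstay : ∀ i, ∀ᵐ x ∂μ, x ∈ Xs i → κ x (Xs i) = 1)
    -- ergodicity of each regime
    (herg : ∀ i, ∀ A : Set X, MeasurableSet A →
      (∀ᵐ p : X × X ∂(μ ⊗ₘ κ), p.1 ∈ Xs i → (p.2 ∈ A ↔ p.1 ∈ A)) →
      μ (A ∩ Xs i) = 0 ∨ μ (A ∩ Xs i) = μ (Xs i))
    -- the a.e.-equivalence classes of the regime indicators in L²(X, μ)
    (χL : Fin r → Lp ℝ 2 μ)
    (hχL : ∀ i, χL i = indicatorConstLp 2 (hmeas i) (measure_ne_top μ (Xs i)) (1 : ℝ))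
    -- the fixed subspace of the Koopman operator in L²(X, μ)
    (F : Set (Lp ℝ 2 μ))
    (hF : F = {ψ : Lp ℝ 2 μ | ∀ᵐ x ∂μ, (∫ y, (ψ : X → ℝ) y ∂(κ x)) = (ψ : X → ℝ) x}) :
    F = (Submodule.span ℝ (Set.range χL) : Submodule ℝ (Lp ℝ 2 μ)) ∧
      Module.rank ℝ (Submodule.span ℝ (Set.range χL)) = r := by
  have hinv' : κ.Invariant μ := hinv
  obtain rfl : χL = fun i ↦ indicatorConstLp 2 (hmeas i) (measure_ne_top μ (Xs i)) (1 : ℝ) :=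
    funext hχL
  subst hF
  refine ⟨Set.Subset.antisymm (fun ψ hψ ↦ ?_) (fun ψ hψ ↦ ?_), ?_⟩
  · have hconst := hinv'.ae_snd_eq_fst (Lp.memLp ψ) hψ
    choose c hc using fun i ↦ Kernel.Invariant.exists_ae_eq_const_of_ergodic
      (Lp.stronglyMeasurable ψ).measurable (hmeas i) hconst (herg i)
    exact Lp.mem_span_indicatorConstLp hmeas hdisj hcover ψ c hc
  · induction hψ using Submodule.span_induction with
    | mem ψ hψ =>
      obtain ⟨i, rfl⟩ := hψ
      have hcoe := indicatorConstLp_coeFn (p := 2) (hs := hmeas i)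
        (hμs := measure_ne_top μ (Xs i)) (c := (1 : ℝ))
      filter_upwards [hcoe, hinv'.ae_ae hcoe,
        hinv'.ae_integral_indicator_eq hmeas hdisj hcover hstay i] with x hx hκx hfix
      rw [hx, integral_congr_ae hκx, hfix]
    | zero =>
      have hcoe := Lp.coeFn_zero ℝ 2 μ
      filter_upwards [hcoe, hinv'.ae_ae hcoe] with x hx hκx
      rw [hx, integral_congr_ae hκx]
      simp
    | add ψ φ _ _ hψ hφ =>
      have hcoe := Lp.coeFn_add ψ φ
      filter_upwards [hcoe, hinv'.ae_ae hcoe, hψ, hφ,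
        hinv'.ae_integrable ((Lp.memLp ψ).integrable one_le_two),
        hinv'.ae_integrable ((Lp.memLp φ).integrable one_le_two)] with x hx hκx hψx hφx hψi hφi
      rw [hx, integral_congr_ae hκx, integral_add' hψi hφi, hψx, hφx, Pi.add_apply]
    | smul a ψ _ hψ =>
      have hcoe := Lp.coeFn_smul a ψ
      rw [Set.mem_ofPred_eq] at hψ ⊢
      filter_upwards [hcoe, hinv'.ae_ae hcoe, hψ] with x hx hκx hψx
      rw [hx, integral_congr_ae hκx]
      simp [integral_const_mul, hψx]
  · have hli := linearIndependent_indicatorConstLp_one hmeas hpos hdisj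
    rw [rank_span hli, ← Cardinal.lift_inj, Cardinal.mk_range_eq_of_injective hli.injective]
    simp
end
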